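/- arXiv:1403.0215 — 2 statements merged into one kernel-verified Lean document; each statement's English description precedes it below -/
import Mathlib

section
/- Let N ≥ 3 and let p be real with 1 < p < N. Let Ω ⊆ ℝ^N be an open set. Then for every C^1 function u : ℝ^N → ℝ whose support is compact and contained in Ω, one has ((N−p)/p)^p ∫_Ω |u(x)|^p/|x|^p dx ≤ ∫_Ω |∇u(x)|^p dx. -/
open MeasureTheory Finset

/-- A compactly supported `C¹` function is controlled at `x` by the integral of its derivative
along the ray from `x` away from the origin. -/
lemma enorm_le_mul_lintegral_enorm_fderiv_smul {E : Type*} [NormedAddCommGroup E]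
    [NormedSpace ℝ E] {u : E → ℝ} (hu : ContDiff ℝ 1 u) (hcs : HasCompactSupport u)
    {x : E} (hx : x ≠ 0) :
    ‖u x‖ₑ ≤ ‖x‖ₑ * ∫⁻ t in Set.Ioi (1 : ℝ), ‖fderiv ℝ u (t • x)‖ₑ := by
  have hf : ContDiff ℝ 1 (u ∘ fun t : ℝ => t • x) := hu.comp (by fun_prop)
  have hfs : HasCompactSupport (u ∘ fun t : ℝ => t • x) :=
    hcs.comp_isClosedEmbedding (isClosedEmbedding_smul_left hx)
  have hd (t : ℝ) : deriv (u ∘ fun t : ℝ => t • x) t = fderiv ℝ u (t • x) x := by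
    have h1 : HasDerivAt (fun t : ℝ => t • x) x t := by
      simpa using (hasDerivAt_id t).smul_const x
    exact ((hu.differentiable one_ne_zero (t • x)).hasFDerivAt.comp_hasDerivAt t h1).deriv
  have key := hfs.integral_Ioi_deriv_eq hf 1
  calc ‖u x‖ₑ = ‖∫ t in Set.Ioi (1 : ℝ), deriv (u ∘ fun t : ℝ => t • x) t‖ₑ := by
        rw [key]; simp
    _ ≤ ∫⁻ t in Set.Ioi (1 : ℝ), ‖deriv (u ∘ fun t : ℝ => t • x) t‖ₑ :=
        enorm_integral_le_lintegral_enorm _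
    _ ≤ ∫⁻ t in Set.Ioi (1 : ℝ), ‖x‖ₑ * ‖fderiv ℝ u (t • x)‖ₑ := by
        refine lintegral_mono fun t => ?_
        rw [hd, mul_comm]
        exact ContinuousLinearMap.le_opENorm _ _
    _ = _ := lintegral_const_mul' _ _ enorm_ne_top

lemma lintegral_comp_smul_addHaar {E : Type*} [NormedAddCommGroup E] [NormedSpace ℝ E]
    [MeasurableSpace E] [BorelSpace E] [FiniteDimensional ℝ E] (μ : Measure E)
    [μ.IsAddHaarMeasure] {g : E → ENNReal} (hg : Measurable g) {t : ℝ} (ht : t ≠ 0) :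
    ∫⁻ x, g (t • x) ∂μ =
      ENNReal.ofReal |(t ^ Module.finrank ℝ E)⁻¹| * ∫⁻ x, g x ∂μ := by
  rw [← lintegral_map hg (measurable_const_smul t), Measure.map_addHaar_smul μ ht,
    lintegral_smul_measure, smul_eq_mul]

lemma lintegral_Ioi_one_rpow_neg {a : ℝ} (ha : 1 < a) :
    ∫⁻ t in Set.Ioi (1 : ℝ), ENNReal.ofReal (t ^ (-a)) = ENNReal.ofReal (1 / (a - 1)) := by
  rw [← ofReal_integral_eq_lintegral_ofReal
    (integrableOn_Ioi_rpow_of_lt (by linarith) one_pos)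
    ((ae_restrict_mem measurableSet_Ioi).mono fun t ht =>
      Real.rpow_nonneg (zero_le_one.trans (le_of_lt ht)) _),
    integral_Ioi_rpow_of_lt (by linarith) one_pos, Real.one_rpow, neg_div, ← div_neg]
  congr 2
  ring

/-- Hölder's inequality on `(1, ∞)` against the weight `t ^ (-a)`. -/
lemma lintegral_Ioi_one_rpow_le {p a : ℝ} (hp : 1 < p) (ha : 1 < a) {g : ℝ → ENNReal}
    (hg : Measurable g) :
    (∫⁻ t in Set.Ioi (1 : ℝ), g t) ^ p ≤
      (∫⁻ t in Set.Ioi (1 : ℝ), g t ^ p * ENNReal.ofReal (t ^ (a * (p - 1)))) *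
        ENNReal.ofReal (1 / (a - 1)) ^ (p - 1) := by
  have hpq := Real.HolderConjugate.conjExponent hp
  set q := p.conjExponent with hq
  have hp0 : 0 < p := hpq.pos
  have hq0 : 0 < q := hpq.symm.pos
  have hpdq : p / q = p - 1 := by
    rw [hq, Real.conjExponent]
    have : p - 1 ≠ 0 := by linarith
    field_simp
  set μ := (volume : Measure ℝ).restrict (Set.Ioi 1)
  have hH := ENNReal.lintegral_mul_le_Lp_mul_Lq μ hpq
    (f := fun t => g t * ENNReal.ofReal (t ^ (a / q)))
    (g := fun t => ENNReal.ofReal (t ^ (-(a / q))))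
    (by fun_prop) (by fun_prop)
  have e1 : ∫⁻ t, ((fun t => g t * ENNReal.ofReal (t ^ (a / q))) *
      fun t => ENNReal.ofReal (t ^ (-(a / q)))) t ∂μ = ∫⁻ t, g t ∂μ := by
    refine setLIntegral_congr_fun measurableSet_Ioi fun t ht => ?_
    have ht0 : 0 < t := one_pos.trans ht
    simp only [Pi.mul_apply]
    rw [mul_assoc, ← ENNReal.ofReal_mul (by positivity), ← Real.rpow_add ht0]
    simp
  have e2 : ∫⁻ t, (g t * ENNReal.ofReal (t ^ (a / q))) ^ p ∂μ =
      ∫⁻ t, g t ^ p * ENNReal.ofReal (t ^ (a * (p - 1))) ∂μ := by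
    refine setLIntegral_congr_fun measurableSet_Ioi fun t ht => ?_
    have ht0 : 0 < t := one_pos.trans ht
    rw [ENNReal.mul_rpow_of_nonneg _ _ hp0.le,
      ENNReal.ofReal_rpow_of_nonneg (by positivity) hp0.le, ← Real.rpow_mul ht0.le, ← hpdq]
    congr 3
    ring
  have e3 : ∫⁻ t, ENNReal.ofReal (t ^ (-(a / q))) ^ q ∂μ = ENNReal.ofReal (1 / (a - 1)) := by
    rw [← lintegral_Ioi_one_rpow_neg ha]
    refine setLIntegral_congr_fun measurableSet_Ioi fun t ht => ?_
    have ht0 : 0 < t := one_pos.trans ht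
    rw [ENNReal.ofReal_rpow_of_nonneg (by positivity) hq0.le, ← Real.rpow_mul ht0.le]
    congr 2
    field_simp
  rw [e1, e2, e3] at hH
  refine (ENNReal.rpow_le_rpow hH hp0.le).trans_eq ?_
  rw [ENNReal.mul_rpow_of_nonneg _ _ hp0.le, ← ENNReal.rpow_mul, ← ENNReal.rpow_mul,
    one_div_mul_cancel hp0.ne', ENNReal.rpow_one, one_div_mul_eq_div, hpdq]

/-- Hardy's inequality on the whole space, with the sharp constant. -/
lemma lintegral_enorm_div_rpow_le {E : Type*} [NormedAddCommGroup E] [NormedSpace ℝ E]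
    [MeasurableSpace E] [BorelSpace E] [FiniteDimensional ℝ E] (μ : Measure E)
    [μ.IsAddHaarMeasure] {p : ℝ} (hp : 1 < p) (hpn : p < Module.finrank ℝ E)
    {u : E → ℝ} (hu : ContDiff ℝ 1 u) (hcs : HasCompactSupport u) :
    ∫⁻ x, ENNReal.ofReal (|u x| ^ p / ‖x‖ ^ p) ∂μ ≤
      ENNReal.ofReal ((p / (Module.finrank ℝ E - p)) ^ p) * ∫⁻ x, ‖fderiv ℝ u x‖ₑ ^ p ∂μ := by
  set d := Module.finrank ℝ E
  have hp0 : 0 < p := by linarith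
  set a : ℝ := d / p with ha
  have ha1 : 1 < a := by rw [ha, one_lt_div hp0]; exact hpn
  have hc : 1 / (a - 1) = p / (d - p) := by
    rw [ha]
    have : (d : ℝ) - p ≠ 0 := by linarith
    field_simp
  have hG : Measurable fun x => ‖fderiv ℝ u x‖ₑ :=
    (hu.continuous_fderiv one_ne_zero).enorm.measurable
  have hpt (x : E) : ENNReal.ofReal (|u x| ^ p / ‖x‖ ^ p) ≤
      (∫⁻ t in Set.Ioi (1 : ℝ), ‖fderiv ℝ u (t • x)‖ₑ) ^ p := by
    rcases eq_or_ne x 0 with rfl | hx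
    · simp [Real.zero_rpow hp0.ne']
    have hx0 : 0 < ‖x‖ := norm_pos_iff.2 hx
    rw [← Real.div_rpow (abs_nonneg _) hx0.le,
      ← ENNReal.ofReal_rpow_of_nonneg (by positivity) hp0.le]
    refine ENNReal.rpow_le_rpow ?_ hp0.le
    rw [ENNReal.ofReal_div_of_pos hx0, ← Real.norm_eq_abs, ofReal_norm, ofReal_norm]
    exact ENNReal.div_le_of_le_mul' (enorm_le_mul_lintegral_enorm_fderiv_smul hu hcs hx)
  have hscale : ∀ t ∈ Set.Ioi (1 : ℝ),
      ∫⁻ x, ‖fderiv ℝ u (t • x)‖ₑ ^ p * ENNReal.ofReal (t ^ (a * (p - 1))) ∂μ =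
        ENNReal.ofReal (t ^ (-a)) * ∫⁻ x, ‖fderiv ℝ u x‖ₑ ^ p ∂μ := by
    intro t ht
    have ht0 : 0 < t := one_pos.trans ht
    rw [lintegral_mul_const' _ _ ENNReal.ofReal_ne_top,
      lintegral_comp_smul_addHaar μ (hG.pow_const p) ht0.ne', mul_right_comm,
      ← ENNReal.ofReal_mul (abs_nonneg _), abs_of_pos (by positivity), ← Real.rpow_natCast,
      ← Real.rpow_neg ht0.le, ← Real.rpow_add ht0]
    congr 3
    rw [ha]
    field_simp
    ring
  calc ∫⁻ x, ENNReal.ofReal (|u x| ^ p / ‖x‖ ^ p) ∂μ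
      ≤ ∫⁻ x, (∫⁻ t in Set.Ioi (1 : ℝ), ‖fderiv ℝ u (t • x)‖ₑ ^ p *
          ENNReal.ofReal (t ^ (a * (p - 1)))) * ENNReal.ofReal (1 / (a - 1)) ^ (p - 1) ∂μ :=
        lintegral_mono fun x => (hpt x).trans
          (lintegral_Ioi_one_rpow_le hp ha1 (hG.comp (by fun_prop)))
    _ = (∫⁻ t in Set.Ioi (1 : ℝ), ∫⁻ x, ‖fderiv ℝ u (t • x)‖ₑ ^ p *
          ENNReal.ofReal (t ^ (a * (p - 1))) ∂μ) * ENNReal.ofReal (1 / (a - 1)) ^ (p - 1) := by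
        rw [lintegral_mul_const' _ _
          (ENNReal.rpow_ne_top_of_nonneg (by linarith) ENNReal.ofReal_ne_top),
          lintegral_lintegral_swap]
        refine Measurable.aemeasurable (Measurable.mul ?_ (by fun_prop))
        exact (hG.comp (measurable_snd.smul measurable_fst)).pow_const p
    _ = ENNReal.ofReal (1 / (a - 1)) * (∫⁻ x, ‖fderiv ℝ u x‖ₑ ^ p ∂μ) *
          ENNReal.ofReal (1 / (a - 1)) ^ (p - 1) := by
        rw [setLIntegral_congr_fun measurableSet_Ioi hscale, lintegral_mul_const _ (by fun_prop),
          lintegral_Ioi_one_rpow_neg ha1]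
    _ = _ := by
        have hpos : 0 < 1 / (a - 1) := one_div_pos.2 (by linarith)
        rw [mul_right_comm, ENNReal.ofReal_rpow_of_pos hpos, ← ENNReal.ofReal_mul hpos.le,
          ← hc]
        nth_rewrite 1 [← Real.rpow_one (1 / (a - 1))]
        rw [← Real.rpow_add hpos, add_sub_cancel]

/-- The classical Hardy inequality on an open set `Ω ⊆ ℝ^N`, `N ≥ 3`, `1 < p < N`:
`((N-p)/p)^p ∫_Ω |u|^p/|x|^p ≤ ∫_Ω |∇u|^p` for `C¹` functions `u` with compact support
contained in `Ω`. -/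
theorem classical_hardy (n : ℕ) (hn : 3 ≤ n)
    (p : ℝ) (hp1 : 1 < p) (hpn : p < n)
    (Ω : Set (EuclideanSpace ℝ (Fin n))) (hΩ : IsOpen Ω)
    (u : EuclideanSpace ℝ (Fin n) → ℝ) (hu : ContDiff ℝ 1 u)
    (hcs : HasCompactSupport u) (hsupp : tsupport u ⊆ Ω) :
    ENNReal.ofReal ((((n : ℝ) - p) / p) ^ p) *
        ∫⁻ x in Ω, ENNReal.ofReal (|u x| ^ p / ‖x‖ ^ p) ≤
      ∫⁻ x in Ω, ENNReal.ofReal (‖gradient u x‖ ^ p) := by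
  have hp0 : 0 < p := by linarith
  have hgrad (x : EuclideanSpace ℝ (Fin n)) :
      ENNReal.ofReal (‖gradient u x‖ ^ p) = ‖fderiv ℝ u x‖ₑ ^ p := by
    rw [gradient, LinearIsometryEquiv.norm_map,
      ← ENNReal.ofReal_rpow_of_nonneg (norm_nonneg _) hp0.le, ofReal_norm]
  have hright : ∫⁻ x in Ω, ENNReal.ofReal (‖gradient u x‖ ^ p) =
      ∫⁻ x, ‖fderiv ℝ u x‖ₑ ^ p := by
    simp_rw [hgrad]
    refine setLIntegral_eq_of_support_subset fun x hx => hsupp ?_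
    refine support_fderiv_subset ℝ fun h => hx ?_
    simp [h, hp0, ← ofReal_norm]
  have hHardy := lintegral_enorm_div_rpow_le volume hp1
    (by rwa [finrank_euclideanSpace_fin]) hu hcs
  rw [finrank_euclideanSpace_fin] at hHardy
  have hnp : 0 < (n : ℝ) - p := by linarith
  calc _ ≤ ENNReal.ofReal ((((n : ℝ) - p) / p) ^ p) *
        (ENNReal.ofReal ((p / (n - p)) ^ p) * ∫⁻ x, ‖fderiv ℝ u x‖ₑ ^ p) := by
        gcongr
        exact (setLIntegral_le_lintegral _ _).trans hHardy
    _ = _ := by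
        rw [hright, ← mul_assoc, ← ENNReal.ofReal_mul (by positivity),
          ← Real.mul_rpow (by positivity) (by positivity), div_mul_div_cancel₀ hp0.ne',
          div_self hnp.ne', Real.one_rpow, ENNReal.ofReal_one, one_mul]
end

section
/- Let Ω ⊆ ℝ^{N_1}×ℝ^{N_2} be open and let p > 1 satisfy p < N_1 and p(1+α) < N_2. Then for every C^1 function u : ℝ^{N_1}×ℝ^{N_2} → ℝ whose support is compact and contained in Ω, one has ((Q−p)/p)^p ∫_Ω ( |x|^{pα} / [[(x,y)]]_λ^{p(1+α)} ) |u(x,y)|^p dx dy ≤ ∫_Ω |∇_λ u(x,y)|^p dx dy. -/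
open MeasureTheory Finset

noncomputable section

/-- the homogeneous norm `[[(x,y)]]_λ = (|x|^{2(1+α)} + (1+α)²|y|²)^{1/(2(1+α))}` associated
to the Grushin operator. -/
def grushinNorm {n₁ n₂ : ℕ} (α : ℝ) (x : EuclideanSpace ℝ (Fin n₁))
    (y : EuclideanSpace ℝ (Fin n₂)) : ℝ :=
  (‖x‖ ^ (2 * (1 + α)) + (1 + α) ^ 2 * ‖y‖ ^ 2) ^ (1 / (2 * (1 + α)))

/-- the gradient in the `x`-variables. -/
def gradX {n₁ n₂ : ℕ}
    (u : EuclideanSpace ℝ (Fin n₁) × EuclideanSpace ℝ (Fin n₂) → ℝ)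
    (x : EuclideanSpace ℝ (Fin n₁)) (y : EuclideanSpace ℝ (Fin n₂)) :
    EuclideanSpace ℝ (Fin n₁) :=
  gradient (fun x' => u (x', y)) x

/-- the gradient in the `y`-variables. -/
def gradY {n₁ n₂ : ℕ}
    (u : EuclideanSpace ℝ (Fin n₁) × EuclideanSpace ℝ (Fin n₂) → ℝ)
    (x : EuclideanSpace ℝ (Fin n₁)) (y : EuclideanSpace ℝ (Fin n₂)) :
    EuclideanSpace ℝ (Fin n₂) :=
  gradient (fun y' => u (x, y')) y

/-- the norm of the Grushin gradient `∇_λ u = (∇_x u, |x|^α ∇_y u)`. -/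
def grushinGradNorm {n₁ n₂ : ℕ} (α : ℝ)
    (u : EuclideanSpace ℝ (Fin n₁) × EuclideanSpace ℝ (Fin n₂) → ℝ)
    (x : EuclideanSpace ℝ (Fin n₁)) (y : EuclideanSpace ℝ (Fin n₂)) : ℝ :=
  Real.sqrt (‖gradX u x y‖ ^ 2 + ‖x‖ ^ (2 * α) * ‖gradY u x y‖ ^ 2)

open scoped ENNReal

/-- The anisotropic dilation `(x, y) ↦ (e^s x, e^{(1+α)s} y)`. -/
def grushinDilation {n₁ n₂ : ℕ} (α s : ℝ)
    (z : EuclideanSpace ℝ (Fin n₁) × EuclideanSpace ℝ (Fin n₂)) :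
    EuclideanSpace ℝ (Fin n₁) × EuclideanSpace ℝ (Fin n₂) :=
  (Real.exp s • z.1, Real.exp ((1 + α) * s) • z.2)

/-- The derivative of `u` along the generator `(x, (1+α)y)` of the anisotropic dilations. -/
def grushinEuler {n₁ n₂ : ℕ} (α : ℝ)
    (u : EuclideanSpace ℝ (Fin n₁) × EuclideanSpace ℝ (Fin n₂) → ℝ)
    (z : EuclideanSpace ℝ (Fin n₁) × EuclideanSpace ℝ (Fin n₂)) : ℝ :=
  fderiv ℝ u z (z.1, (1 + α) • z.2)

/-- The weight `|x|^α / [[(x,y)]]_λ^{1+α}`. -/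
def grushinWeight {n₁ n₂ : ℕ} (α : ℝ)
    (z : EuclideanSpace ℝ (Fin n₁) × EuclideanSpace ℝ (Fin n₂)) : ℝ :=
  ‖z.1‖ ^ α / √(‖z.1‖ ^ (2 * (1 + α)) + (1 + α) ^ 2 * ‖z.2‖ ^ 2)

section

variable {n₁ n₂ : ℕ} {α p : ℝ}
  {u : EuclideanSpace ℝ (Fin n₁) × EuclideanSpace ℝ (Fin n₂) → ℝ}

lemma grushinWeight_nonneg (α : ℝ)
    (z : EuclideanSpace ℝ (Fin n₁) × EuclideanSpace ℝ (Fin n₂)) : 0 ≤ grushinWeight α z := by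
  unfold grushinWeight
  positivity

lemma measurable_grushinWeight (α : ℝ) : Measurable
    (grushinWeight α : EuclideanSpace ℝ (Fin n₁) × EuclideanSpace ℝ (Fin n₂) → ℝ) := by
  unfold grushinWeight
  fun_prop

lemma grushinWeight_zero (hα : 0 ≤ α) : grushinWeight α
    (0 : EuclideanSpace ℝ (Fin n₁) × EuclideanSpace ℝ (Fin n₂)) = 0 := by
  have : 2 * (1 + α) ≠ 0 := by positivity
  simp [grushinWeight, Real.zero_rpow this]

lemma weight_eq_rpow (hα : 0 ≤ α)
    (z : EuclideanSpace ℝ (Fin n₁) × EuclideanSpace ℝ (Fin n₂)) :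
    ‖z.1‖ ^ (p * α) / grushinNorm α z.1 z.2 ^ (p * (1 + α)) = grushinWeight α z ^ p := by
  have hα1 : 1 + α ≠ 0 := by positivity
  unfold grushinWeight grushinNorm
  rw [Real.div_rpow (by positivity) (by positivity), ← Real.rpow_mul (by positivity),
    ← Real.rpow_mul (by positivity), Real.sqrt_eq_rpow, ← Real.rpow_mul (by positivity),
    mul_comm p α]
  congr 2
  field_simp

lemma grushinWeight_dilation (α s : ℝ)
    (z : EuclideanSpace ℝ (Fin n₁) × EuclideanSpace ℝ (Fin n₂)) :
    grushinWeight α (grushinDilation α s z) = Real.exp (-s) * grushinWeight α z := by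
  have h : ‖Real.exp s • z.1‖ ^ (2 * (1 + α)) +
      (1 + α) ^ 2 * ‖Real.exp ((1 + α) * s) • z.2‖ ^ 2 =
      Real.exp ((1 + α) * s) ^ 2 *
        (‖z.1‖ ^ (2 * (1 + α)) + (1 + α) ^ 2 * ‖z.2‖ ^ 2) := by
    rw [norm_smul, norm_smul, Real.mul_rpow (by positivity) (by positivity),
      Real.norm_of_nonneg (Real.exp_nonneg _), Real.norm_of_nonneg (Real.exp_nonneg _),
      ← Real.exp_mul, ← Real.exp_nat_mul,
      show s * (2 * (1 + α)) = (2 : ℕ) * ((1 + α) * s) by push_cast; ring, Real.exp_nat_mul]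
    ring
  simp only [grushinWeight, grushinDilation]
  rw [h, Real.sqrt_mul (by positivity), Real.sqrt_sq (by positivity), norm_smul,
    Real.mul_rpow (by positivity) (by positivity), Real.norm_of_nonneg (Real.exp_nonneg _),
    ← Real.exp_mul, mul_div_mul_comm, ← Real.exp_sub]
  congr 2
  ring

lemma measurable_grushinDilation (α s : ℝ) : Measurable
    (grushinDilation α s : EuclideanSpace ℝ (Fin n₁) × EuclideanSpace ℝ (Fin n₂) → _) := by
  unfold grushinDilation
  fun_prop

lemma lintegral_comp_grushinDilation (α s : ℝ)
    {f : EuclideanSpace ℝ (Fin n₁) × EuclideanSpace ℝ (Fin n₂) → ℝ≥0∞} (hf : Measurable f) :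
    ∫⁻ z, f (grushinDilation α s z) =
      ENNReal.ofReal (Real.exp (-(n₁ + (1 + α) * n₂) * s)) * ∫⁻ z, f z := by
  have hmap (n : ℕ) (c : ℝ) :
      Measure.map (Real.exp c • · : EuclideanSpace ℝ (Fin n) → _) volume =
        ENNReal.ofReal (Real.exp (-n * c)) • volume := by
    rw [Measure.map_addHaar_smul _ (Real.exp_ne_zero c), finrank_euclideanSpace_fin,
      ← Real.exp_nat_mul, ← Real.exp_neg, abs_of_pos (Real.exp_pos _), neg_mul]
  have h : Measure.map (grushinDilation α s) volume =
      ENNReal.ofReal (Real.exp (-(n₁ + (1 + α) * n₂) * s)) •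
        (volume : Measure (EuclideanSpace ℝ (Fin n₁) × EuclideanSpace ℝ (Fin n₂))) := by
    change Measure.map (Prod.map (Real.exp s • ·) (Real.exp ((1 + α) * s) • ·))
      (volume.prod volume) = _
    rw [← Measure.map_prod_map _ _ (by fun_prop) (by fun_prop), hmap, hmap,
      Measure.prod_smul_left, Measure.prod_smul_right, smul_smul,
      ← ENNReal.ofReal_mul (Real.exp_nonneg _), ← Real.exp_add, Measure.volume_eq_prod]
    congr 3
    ring
  rw [← lintegral_map hf (measurable_grushinDilation α s), h, lintegral_smul_measure, smul_eq_mul]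

lemma hasDerivAt_grushinDilation (α s : ℝ)
    (z : EuclideanSpace ℝ (Fin n₁) × EuclideanSpace ℝ (Fin n₂)) :
    HasDerivAt (fun t => grushinDilation α t z)
      ((grushinDilation α s z).1, (1 + α) • (grushinDilation α s z).2) s := by
  have h1 := (Real.hasDerivAt_exp s).smul_const z.1
  have h2 := ((hasDerivAt_id s).const_mul (1 + α)).exp.smul_const z.2
  refine (h1.prodMk h2).congr_deriv ?_
  simp [grushinDilation, smul_smul, mul_comm]

lemma contDiff_grushinDilation (α : ℝ)
    (z : EuclideanSpace ℝ (Fin n₁) × EuclideanSpace ℝ (Fin n₂)) :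
    ContDiff ℝ 1 (fun t => grushinDilation α t z) := by
  unfold grushinDilation
  fun_prop

lemma continuous_grushinDilation_uncurry (α : ℝ) : Continuous
    (fun q : (EuclideanSpace ℝ (Fin n₁) × EuclideanSpace ℝ (Fin n₂)) × ℝ =>
      grushinDilation α q.2 q.1) := by
  unfold grushinDilation
  fun_prop

lemma continuous_grushinEuler (α : ℝ) (hu : ContDiff ℝ 1 u) :
    Continuous (grushinEuler α u) := by
  unfold grushinEuler
  exact (hu.continuous_fderiv one_ne_zero).clm_apply (by fun_prop)

lemma exists_grushinDilation_eq_zero (hα : 0 ≤ α) (hcs : HasCompactSupport u)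
    {z : EuclideanSpace ℝ (Fin n₁) × EuclideanSpace ℝ (Fin n₂)} (hz : z ≠ 0) :
    ∃ s, 0 ≤ s ∧ u (grushinDilation α s z) = 0 := by
  obtain ⟨R, hR⟩ := hcs.isBounded.exists_norm_le
  have hzpos : 0 < ‖z‖ := norm_pos_iff.2 hz
  have hlarge : ∃ s, 0 ≤ s ∧ R < Real.exp s * ‖z‖ := by
    have h := (Real.tendsto_exp_atTop.atTop_mul_const hzpos).eventually_gt_atTop R
    obtain ⟨s, hs, hs'⟩ := ((Filter.eventually_ge_atTop (0 : ℝ)).and h).exists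
    exact ⟨s, hs, hs'⟩
  obtain ⟨s, hs, hRs⟩ := hlarge
  refine ⟨s, hs, image_eq_zero_of_notMem_tsupport fun hmem => ?_⟩
  have hexp : Real.exp s ≤ Real.exp ((1 + α) * s) := Real.exp_le_exp.2 (by nlinarith)
  have hle : Real.exp s * ‖z‖ ≤ ‖grushinDilation α s z‖ := by
    rw [Prod.norm_def, Prod.norm_def, mul_max_of_nonneg _ _ (Real.exp_nonneg s)]
    simp only [grushinDilation, norm_smul, Real.norm_of_nonneg (Real.exp_nonneg _)]
    gcongr
  linarith [hR _ hmem]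

lemma enorm_le_lintegral_grushinEuler (hα : 0 ≤ α) (hu : ContDiff ℝ 1 u)
    (hcs : HasCompactSupport u)
    {z : EuclideanSpace ℝ (Fin n₁) × EuclideanSpace ℝ (Fin n₂)} (hz : z ≠ 0) :
    ‖u z‖ₑ ≤ ∫⁻ s in Set.Ioi (0 : ℝ), ‖grushinEuler α u (grushinDilation α s z)‖ₑ := by
  obtain ⟨S, hS, hS0⟩ := exists_grushinDilation_eq_zero hα hcs hz
  have hderiv (s : ℝ) : deriv (fun t => u (grushinDilation α t z)) s =
      grushinEuler α u (grushinDilation α s z) :=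
    ((hu.differentiable one_ne_zero _).hasFDerivAt.comp_hasDerivAt s
      (hasDerivAt_grushinDilation α s z)).deriv
  have h := enorm_sub_le_lintegral_deriv_of_contDiffOn_Icc
    (hu.comp (contDiff_grushinDilation α z)).contDiffOn hS
  have h0 : grushinDilation α 0 z = z := by simp [grushinDilation]
  simp only [Function.comp_def, hS0, h0, zero_sub, enorm_neg, hderiv] at h
  refine h.trans ?_
  rw [← restrict_Ioc_eq_restrict_Icc]
  exact lintegral_mono_set Set.Ioc_subset_Ioi_self

lemma lintegral_exp_neg_mul_Ioi {k : ℝ} (hk : 0 < k) :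
    ∫⁻ s in Set.Ioi (0 : ℝ), ENNReal.ofReal (Real.exp (-k * s)) = ENNReal.ofReal k⁻¹ := by
  rw [← ofReal_integral_eq_lintegral_ofReal (integrableOn_exp_mul_Ioi (by linarith) 0)
    (Filter.Eventually.of_forall fun s => Real.exp_nonneg _), integral_exp_mul_Ioi (by linarith)]
  simp [neg_div_neg_eq]

/-- Hölder's inequality on the half-line with an exponential weight. -/
lemma rpow_lintegral_Ioi_le {k : ℝ} (hp : 1 < p) (hk : 0 < k) {f : ℝ → ℝ≥0∞}
    (hf : Measurable f) :
    (∫⁻ s in Set.Ioi (0 : ℝ), f s) ^ p ≤ ENNReal.ofReal (k⁻¹ ^ (p - 1)) *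
      ∫⁻ s in Set.Ioi (0 : ℝ), ENNReal.ofReal (Real.exp ((p - 1) * k * s)) * f s ^ p := by
  have hp0 : 0 < p := by linarith
  have hp1 : p - 1 ≠ 0 := by linarith
  have hpq := Real.HolderConjugate.conjExponent hp
  set c := (p - 1) * k / p with hc
  have h := ENNReal.lintegral_mul_le_Lp_mul_Lq (volume.restrict (Set.Ioi (0 : ℝ))) hpq
    (f := fun s => ENNReal.ofReal (Real.exp (c * s)) * f s)
    (g := fun s => ENNReal.ofReal (Real.exp (-c * s))) (by fun_prop) (by fun_prop)
  have hprod (s : ℝ) : ENNReal.ofReal (Real.exp (c * s)) * f s *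
      ENNReal.ofReal (Real.exp (-c * s)) = f s := by
    rw [mul_right_comm, ← ENNReal.ofReal_mul (Real.exp_nonneg _), ← Real.exp_add]
    simp
  have hF (s : ℝ) : (ENNReal.ofReal (Real.exp (c * s)) * f s) ^ p =
      ENNReal.ofReal (Real.exp ((p - 1) * k * s)) * f s ^ p := by
    rw [ENNReal.mul_rpow_of_nonneg _ _ hp0.le, ENNReal.ofReal_rpow_of_pos (Real.exp_pos _),
      ← Real.exp_mul, hc]
    congr 3
    field_simp
  have hG (s : ℝ) : ENNReal.ofReal (Real.exp (-c * s)) ^ p.conjExponent =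
      ENNReal.ofReal (Real.exp (-k * s)) := by
    rw [ENNReal.ofReal_rpow_of_pos (Real.exp_pos _), ← Real.exp_mul, hc, Real.conjExponent]
    congr 2
    field_simp
  simp only [Pi.mul_apply, hprod, hF, hG, lintegral_exp_neg_mul_Ioi hk] at h
  calc
    _ ≤ _ := ENNReal.rpow_le_rpow h hp0.le
    _ = _ := by
      rw [ENNReal.mul_rpow_of_nonneg _ _ hp0.le, ← ENNReal.rpow_mul, ← ENNReal.rpow_mul,
        one_div_mul_cancel hp0.ne', ENNReal.rpow_one, mul_comm,
        ENNReal.ofReal_rpow_of_pos (inv_pos.2 hk), Real.conjExponent]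
      congr 3
      field_simp

lemma lintegral_weight_grushinEuler_dilation (hu : ContDiff ℝ 1 u) (s : ℝ) :
    ∫⁻ z, ENNReal.ofReal (grushinWeight α z ^ p) *
        ‖grushinEuler α u (grushinDilation α s z)‖ₑ ^ p =
      ENNReal.ofReal (Real.exp (-(n₁ + (1 + α) * n₂ - p) * s)) *
        ∫⁻ z, ENNReal.ofReal (grushinWeight α z ^ p) * ‖grushinEuler α u z‖ₑ ^ p := by
  have hE := (continuous_grushinEuler α hu).measurable
  have hW := measurable_grushinWeight (n₁ := n₁) (n₂ := n₂) α
  have hweight (z : EuclideanSpace ℝ (Fin n₁) × EuclideanSpace ℝ (Fin n₂)) :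
      ENNReal.ofReal (grushinWeight α z ^ p) = ENNReal.ofReal (Real.exp (p * s)) *
        ENNReal.ofReal (grushinWeight α (grushinDilation α s z) ^ p) := by
    rw [← ENNReal.ofReal_mul (Real.exp_nonneg _), grushinWeight_dilation,
      Real.mul_rpow (Real.exp_nonneg _) (grushinWeight_nonneg α z), ← Real.exp_mul, ← mul_assoc,
      ← Real.exp_add, show p * s + -s * p = 0 by ring, Real.exp_zero, one_mul]
  have h := lintegral_comp_grushinDilation α s (n₁ := n₁) (n₂ := n₂)
    (f := fun z => ENNReal.ofReal (grushinWeight α z ^ p) * ‖grushinEuler α u z‖ₑ ^ p)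
    (by fun_prop)
  calc
    _ = ∫⁻ z, ENNReal.ofReal (Real.exp (p * s)) *
        (ENNReal.ofReal (grushinWeight α (grushinDilation α s z) ^ p) *
          ‖grushinEuler α u (grushinDilation α s z)‖ₑ ^ p) := by
      simp_rw [← mul_assoc, ← hweight]
    _ = _ := by
      rw [lintegral_const_mul' _ _ ENNReal.ofReal_ne_top, h, ← mul_assoc,
        ← ENNReal.ofReal_mul (Real.exp_nonneg _), ← Real.exp_add]
      congr 3
      ring

lemma weighted_euler_inequality (hα : 0 ≤ α) (hp : 1 < p)
    (hk : 0 < (n₁ + (1 + α) * n₂ - p) / p) (hu : ContDiff ℝ 1 u) (hcs : HasCompactSupport u) :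
    ENNReal.ofReal (((n₁ + (1 + α) * n₂ - p) / p) ^ p) *
        ∫⁻ z, ENNReal.ofReal (grushinWeight α z ^ p) * ‖u z‖ₑ ^ p ≤
      ∫⁻ z, ENNReal.ofReal (grushinWeight α z ^ p) * ‖grushinEuler α u z‖ₑ ^ p := by
  have hp0 : 0 < p := by linarith
  set k := (n₁ + (1 + α) * n₂ - p) / p with hkdef
  have hkp : n₁ + (1 + α) * n₂ - p = k * p := by rw [hkdef]; field_simp
  have hE := continuous_grushinEuler α hu
  have hW := measurable_grushinWeight (n₁ := n₁) (n₂ := n₂) α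
  have hED : Measurable
      (fun q : (EuclideanSpace ℝ (Fin n₁) × EuclideanSpace ℝ (Fin n₂)) × ℝ =>
        grushinEuler α u (grushinDilation α q.2 q.1)) :=
    (hE.comp (continuous_grushinDilation_uncurry α)).measurable
  set A := ∫⁻ z, ENNReal.ofReal (grushinWeight α z ^ p) * ‖grushinEuler α u z‖ₑ ^ p with hA
  have hpoint (z : EuclideanSpace ℝ (Fin n₁) × EuclideanSpace ℝ (Fin n₂)) :
      ENNReal.ofReal (grushinWeight α z ^ p) * ‖u z‖ₑ ^ p ≤
        ENNReal.ofReal (k⁻¹ ^ (p - 1)) * ∫⁻ s in Set.Ioi (0 : ℝ),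
          ENNReal.ofReal (Real.exp ((p - 1) * k * s)) *
            (ENNReal.ofReal (grushinWeight α z ^ p) *
              ‖grushinEuler α u (grushinDilation α s z)‖ₑ ^ p) := by
    rcases eq_or_ne z 0 with rfl | hz
    · simp [grushinWeight_zero hα, Real.zero_rpow hp0.ne']
    · simp_rw [mul_left_comm _ (ENNReal.ofReal (grushinWeight α z ^ p))]
      rw [lintegral_const_mul' _ _ ENNReal.ofReal_ne_top, mul_left_comm]
      gcongr
      refine (ENNReal.rpow_le_rpow (enorm_le_lintegral_grushinEuler hα hu hcs hz) hp0.le).trans ?_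
      exact rpow_lintegral_Ioi_le hp hk
        (hED.comp (measurable_const.prodMk measurable_id)).enorm
  have hbound : ∫⁻ z, ENNReal.ofReal (grushinWeight α z ^ p) * ‖u z‖ₑ ^ p ≤
      ENNReal.ofReal (k⁻¹ ^ p) * A := by
    refine (lintegral_mono hpoint).trans_eq ?_
    rw [lintegral_const_mul' _ _ ENNReal.ofReal_ne_top, lintegral_lintegral_swap]
    · simp_rw [lintegral_const_mul' _ _ ENNReal.ofReal_ne_top,
        lintegral_weight_grushinEuler_dilation hu, ← hA, ← mul_assoc,
        ← ENNReal.ofReal_mul (Real.exp_nonneg _), ← Real.exp_add, hkp,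
        show ∀ s, (p - 1) * k * s + -(k * p) * s = -k * s by intro s; ring]
      rw [lintegral_mul_const _ (by fun_prop), lintegral_exp_neg_mul_Ioi hk, ← mul_assoc,
        ← ENNReal.ofReal_mul (by positivity)]
      nth_rewrite 2 [← Real.rpow_one k⁻¹]
      rw [← Real.rpow_add (inv_pos.2 hk), sub_add_cancel]
    · simp only [Function.uncurry_def]
      fun_prop
  calc
    _ ≤ ENNReal.ofReal (k ^ p) * (ENNReal.ofReal (k⁻¹ ^ p) * A) := by gcongr
    _ = A := by
      rw [← mul_assoc, ← ENNReal.ofReal_mul (by positivity), ← Real.mul_rpow hk.le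
        (by positivity), mul_inv_cancel₀ hk.ne', Real.one_rpow, ENNReal.ofReal_one, one_mul]

lemma grushinEuler_eq_inner (α : ℝ) (hu : ContDiff ℝ 1 u)
    (z : EuclideanSpace ℝ (Fin n₁) × EuclideanSpace ℝ (Fin n₂)) :
    grushinEuler α u z =
      inner ℝ (gradX u z.1 z.2) z.1 + (1 + α) * inner ℝ (gradY u z.1 z.2) z.2 := by
  have hd : HasFDerivAt u (fderiv ℝ u z) (z.1, z.2) :=
    (hu.differentiable one_ne_zero z).hasFDerivAt
  have hX := (HasFDerivAt.comp (f := fun x => (x, z.2)) z.1 hd (hasFDerivAt_prodMk_left z.1 z.2)).fderiv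
  have hY := (HasFDerivAt.comp (f := fun y => (z.1, y)) z.2 hd (hasFDerivAt_prodMk_right z.1 z.2)).fderiv
  simp only [Function.comp_def] at hX hY
  rw [gradX, gradY, inner_gradient_left, inner_gradient_left, hX, hY, grushinEuler,
    show (z.1, (1 + α) • z.2) = (z.1, 0) + (1 + α) • (0, z.2) by simp, map_add, map_smul]
  simp

lemma grushinWeight_mul_abs_grushinEuler_le (hα : 0 ≤ α) (hu : ContDiff ℝ 1 u)
    (z : EuclideanSpace ℝ (Fin n₁) × EuclideanSpace ℝ (Fin n₂)) :
    grushinWeight α z * |grushinEuler α u z| ≤ grushinGradNorm α u z.1 z.2 := by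
  have hα1 : 0 < 1 + α := by linarith
  set a := ‖z.1‖ ^ α with ha
  have ha0 : 0 ≤ a := by positivity
  have ha2 : ‖z.1‖ ^ (2 * α) = a ^ 2 := by
    rw [ha, ← Real.rpow_mul_natCast (norm_nonneg _), mul_comm]; norm_num
  have hS : ‖z.1‖ ^ (2 * (1 + α)) = a ^ 2 * ‖z.1‖ ^ 2 := by
    rw [mul_add, mul_one, Real.rpow_add_of_nonneg (norm_nonneg _) (by norm_num) (by positivity),
      ha2, mul_comm]
    norm_num
  have hE : |grushinEuler α u z| ≤
      ‖gradX u z.1 z.2‖ * ‖z.1‖ + (1 + α) * (‖gradY u z.1 z.2‖ * ‖z.2‖) := by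
    rw [grushinEuler_eq_inner α hu]
    refine (abs_add_le _ _).trans (add_le_add (abs_real_inner_le_norm _ _) ?_)
    rw [abs_mul, abs_of_pos hα1]
    gcongr
    exact abs_real_inner_le_norm _ _
  rw [grushinWeight, grushinGradNorm, hS, ha2, ← ha, div_mul_eq_mul_div]
  refine div_le_of_le_mul₀ (by positivity) (by positivity) ?_
  rw [← Real.sqrt_mul (by positivity)]
  refine (mul_le_mul_of_nonneg_left hE ha0).trans (Real.le_sqrt_of_sq_le ?_)
  nlinarith [sq_nonneg (‖gradX u z.1 z.2‖ * ((1 + α) * ‖z.2‖) -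
    a ^ 2 * ‖z.1‖ * ‖gradY u z.1 z.2‖)]

lemma grushinGradNorm_eq_zero (α : ℝ)
    {z : EuclideanSpace ℝ (Fin n₁) × EuclideanSpace ℝ (Fin n₂)} (hz : z ∉ tsupport u) :
    grushinGradNorm α u z.1 z.2 = 0 := by
  have h0 : u =ᶠ[nhds (z.1, z.2)] 0 := notMem_tsupport_iff_eventuallyEq.1 hz
  have hX : (fun x => u (x, z.2)) =ᶠ[nhds z.1] fun _ => 0 :=
    (Continuous.prodMk_left z.2).continuousAt.eventually h0
  have hY : (fun y => u (z.1, y)) =ᶠ[nhds z.2] fun _ => 0 :=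
    (Continuous.prodMk_right z.1).continuousAt.eventually h0
  simp [grushinGradNorm, gradX, gradY, gradient, hX.fderiv_eq, hY.fderiv_eq]

end

/-- the Hardy inequality for Grushin-type operators:
`((Q-p)/p)^p ∫_Ω (|x|^{pα}/[[(x,y)]]_λ^{p(1+α)})|u|^p ≤ ∫_Ω |∇_λ u|^p`,
where `Q = N₁ + (1+α)N₂`. -/
theorem hardy_grushin (n₁ n₂ : ℕ) (h₁ : 1 ≤ n₁) (h₂ : 1 ≤ n₂)
    (α : ℝ) (hα : 0 ≤ α)
    (Ω : Set (EuclideanSpace ℝ (Fin n₁) × EuclideanSpace ℝ (Fin n₂))) (hΩ : IsOpen Ω)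
    (p : ℝ) (hp : 1 < p) (hp1 : p < n₁) (hp2 : p * (1 + α) < n₂)
    (u : EuclideanSpace ℝ (Fin n₁) × EuclideanSpace ℝ (Fin n₂) → ℝ)
    (hu : ContDiff ℝ 1 u) (hcs : HasCompactSupport u) (hsupp : tsupport u ⊆ Ω) :
    ENNReal.ofReal (((((n₁ : ℝ) + (1 + α) * n₂) - p) / p) ^ p) *
        ∫⁻ z in Ω,
          ENNReal.ofReal
            (‖z.1‖ ^ (p * α) / grushinNorm α z.1 z.2 ^ (p * (1 + α)) * |u z| ^ p) ≤
      ∫⁻ z in Ω, ENNReal.ofReal (grushinGradNorm α u z.1 z.2 ^ p) := by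
  have hα1 : 0 < 1 + α := by linarith
  have hn2 : (0 : ℝ) < n₂ := by exact_mod_cast h₂
  set Q : ℝ := (n₁ : ℝ) + (1 + α) * n₂ with hQ
  have hk : 0 < (Q - p) / p := by
    have : 0 < (1 + α) * n₂ := by positivity
    exact div_pos (by linarith) (by linarith)
  have hright : ∫⁻ z in Ω, ENNReal.ofReal (grushinGradNorm α u z.1 z.2 ^ p) =
      ∫⁻ z : EuclideanSpace ℝ (Fin n₁) × EuclideanSpace ℝ (Fin n₂),
        ENNReal.ofReal (grushinGradNorm α u z.1 z.2 ^ p) := by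
    rw [← lintegral_indicator hΩ.measurableSet]
    congr 1
    refine Set.indicator_eq_self.2 (Function.support_subset_iff'.2 fun z hz => ?_)
    rw [grushinGradNorm_eq_zero α fun h => hz (hsupp h), Real.zero_rpow (by linarith),
      ENNReal.ofReal_zero]
  rw [hright]
  calc
    _ ≤ ENNReal.ofReal (((Q - p) / p) ^ p) *
        ∫⁻ z, ENNReal.ofReal (grushinWeight α z ^ p) * ‖u z‖ₑ ^ p := by
      refine mul_le_mul' le_rfl ?_
      refine (setLIntegral_le_lintegral _ _).trans (lintegral_mono fun z => le_of_eq ?_)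
      rw [weight_eq_rpow hα, ENNReal.ofReal_mul (Real.rpow_nonneg (grushinWeight_nonneg α z) p),
        ← ENNReal.ofReal_rpow_of_nonneg (abs_nonneg (u z)) (by linarith), Real.enorm_eq_ofReal_abs]
    _ ≤ ∫⁻ z, ENNReal.ofReal (grushinWeight α z ^ p) * ‖grushinEuler α u z‖ₑ ^ p :=
      weighted_euler_inequality hα hp hk hu hcs
    _ ≤ _ := by
      refine lintegral_mono fun z => ?_
      have hw := grushinWeight_nonneg α z
      rw [Real.enorm_eq_ofReal_abs, ENNReal.ofReal_rpow_of_nonneg (abs_nonneg _) (by linarith),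
        ← ENNReal.ofReal_mul (by positivity), ← Real.mul_rpow hw (abs_nonneg _)]
      gcongr
      exact grushinWeight_mul_abs_grushinEuler_le hα hu z

end
end
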